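/- Let θ be a smooth mean-zero function on the 2-torus and Λ = (-Δ)^{1/2}. Then for any even integer p ≥ 2 (or p ≥ 2 real, with |θ|^{p-2}θ interpreted appropriately), ∫ |θ|^{p-2} θ Λθ dx ≥ 0. -/

import Mathlib

open MeasureTheory Real

/-- Euclidean norm of a lattice point in `ℤ²`. -/
noncomputable def en (j : ℤ × ℤ) : ℝ := Real.sqrt ((j.1 : ℝ) ^ 2 + (j.2 : ℝ) ^ 2)

/-- `2π`-periodicity in both variables. -/
def Periodic2 (f : ℝ × ℝ → ℝ) : Prop :=
  ∀ p : ℝ × ℝ, f (p.1 + 2 * π, p.2) = f p ∧ f (p.1, p.2 + 2 * π) = f p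

/-- Lebesgue measure restricted to the period box `[0,2π]²`. -/
noncomputable def μbox : Measure (ℝ × ℝ) :=
  volume.restrict (Set.Icc 0 (2 * π) ×ˢ Set.Icc 0 (2 * π))

/-- Fourier coefficient on the 2-torus of a real-valued function:
`f̂(j) = (2π)⁻² ∫_{[0,2π]²} f(x) e^{-i j·x} dx`. -/
noncomputable def fCoeffR (f : ℝ × ℝ → ℝ) (j : ℤ × ℤ) : ℂ :=
  (1 / (2 * π) ^ 2) *
    ∫ p, (f p : ℂ) * Complex.exp (-Complex.I * ((j.1 : ℝ) * p.1 + (j.2 : ℝ) * p.2)) ∂μbox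

theorem ds_sum_nonneg {α ι : Type*} [Countable ι] [MeasurableSpace α] (μ : Measure α)
    (c w : ι → ℝ) (F : ι → α → ℝ) (hF0 : ∀ j x, 0 ≤ F j x) (hFi : ∀ j, Integrable (F j) μ)
    (hw : ∀ j, ∫ x, F j x ∂μ = w j) (hs : Summable fun j => |c j| * w j)
    (hpos : ∀ᵐ x ∂μ, 0 ≤ ∑' j, c j * F j x) : 0 ≤ ∑' j, c j * w j := by
  have h := hasSum_integral_of_summable_integral_norm (μ := μ) (F := fun j x => c j * F j x)
    (fun j => (hFi j).const_mul _) (by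
      refine hs.congr fun j => ?_
      simp only [norm_mul, Real.norm_eq_abs, abs_of_nonneg (hF0 j _), integral_const_mul, hw])
  have h2 : (fun j => ∫ x, c j * F j x ∂μ) = fun j => c j * w j := by
    funext j; rw [integral_const_mul, hw]
  rw [h2] at h
  rw [h.tsum_eq]
  exact integral_nonneg_of_ae hpos

noncomputable def dsh (r : ℝ) : ℝ := (1 - Real.cos r) / r ^ 2

theorem dsh_nonneg (r : ℝ) : 0 ≤ dsh r :=
  div_nonneg (by linarith [Real.cos_le_one r]) (sq_nonneg r)

theorem dsh_integrable : IntegrableOn dsh (Set.Ioi 0) := by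
  refine Integrable.mono' (g := fun r : ℝ => 4 * (1 + r ^ 2)⁻¹)
    ((integrable_inv_one_add_sq.const_mul 4).integrableOn) ?_ ?_
  · refine Measurable.aestronglyMeasurable ?_
    unfold dsh; fun_prop
  · refine Filter.Eventually.of_forall fun r => ?_
    rw [Real.norm_eq_abs, abs_of_nonneg (dsh_nonneg r), dsh]
    rcases eq_or_ne r 0 with rfl | hr
    · simp
    · have h1 := Real.one_sub_sq_div_two_le_cos (x := r)
      have h2 := Real.neg_one_le_cos r
      rw [← div_eq_mul_inv, div_le_div_iff₀ (by positivity) (by positivity)]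
      nlinarith [sq_nonneg r]

noncomputable def dsK : ℝ := ∫ r in Set.Ioi 0, dsh r

theorem dsK_pos : 0 < dsK := by
  have h1 : 0 < ∫ r in (1:ℝ)..2, dsh r := by
    refine intervalIntegral.intervalIntegral_pos_of_pos_on ?_ ?_ (by norm_num)
    · rw [intervalIntegrable_iff_integrableOn_Ioc_of_le (by norm_num)]
      exact dsh_integrable.mono_set fun x hx => lt_trans one_pos hx.1
    · intro x hx
      refine div_pos ?_ (pow_pos (lt_trans one_pos hx.1) 2)
      have : Real.cos x < Real.cos 0 :=
        Real.cos_lt_cos_of_nonneg_of_le_pi le_rfl (by linarith [hx.2, Real.pi_gt_three])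
          (lt_trans one_pos hx.1)
      rw [Real.cos_zero] at this
      linarith
  rw [intervalIntegral.integral_of_le (by norm_num)] at h1
  refine lt_of_lt_of_le h1 (setIntegral_mono_set dsh_integrable ?_ ?_)
  · exact Filter.Eventually.of_forall dsh_nonneg
  · exact LE.le.eventuallyLE fun x hx => lt_trans one_pos hx.1

theorem dsh_scale (a r : ℝ) (ha : a ≠ 0) :
    (1 - Real.cos (a * r)) / r ^ 2 = |a| ^ 2 * dsh (|a| * r) := by
  have : Real.cos (a * r) = Real.cos (|a| * r) := by
    rcases abs_choice a with h | h <;> rw [h]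
    rw [neg_mul, Real.cos_neg]
  rw [this, dsh, mul_pow]
  have : |a| ≠ 0 := abs_ne_zero.mpr ha
  rcases eq_or_ne r 0 with rfl | hr
  · simp
  · field_simp

theorem ds_int1 (a : ℝ) : IntegrableOn (fun r => (1 - Real.cos (a * r)) / r ^ 2) (Set.Ioi 0) ∧
    ∫ r in Set.Ioi 0, (1 - Real.cos (a * r)) / r ^ 2 = |a| * dsK := by
  rcases eq_or_ne a 0 with rfl | ha
  · simp
  have hp : 0 < |a| := abs_pos.mpr ha
  simp_rw [dsh_scale a _ ha]
  constructor
  · refine Integrable.const_mul ?_ _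
    have := (integrableOn_Ioi_comp_mul_left_iff dsh 0 hp).2 (by simpa using dsh_integrable)
    exact this
  · rw [integral_const_mul, integral_comp_mul_left_Ioi _ _ hp, mul_zero, smul_eq_mul, dsK]
    field_simp

noncomputable def dsM : ℝ := ∫ φ in (0:ℝ)..(2 * π), |Real.cos φ|

theorem dsM_pos : 0 < dsM := by
  refine intervalIntegral.integral_pos Real.two_pi_pos (by fun_prop) (fun _ _ => abs_nonneg _)
    ⟨0, ⟨le_rfl, Real.two_pi_pos.le⟩, by simp⟩

theorem ds_int2 (a b : ℝ) :
    ∫ φ in (0:ℝ)..(2 * π), |a * Real.cos φ + b * Real.sin φ| = √(a ^ 2 + b ^ 2) * dsM := by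
  set z : ℂ := ⟨a, b⟩
  have hz : ‖z‖ = √(a ^ 2 + b ^ 2) := by
    rw [Complex.norm_def, Complex.normSq_apply]; simp [z, sq]
  have ha : a = ‖z‖ * Real.cos z.arg := (Complex.norm_mul_cos_arg z).symm
  have hb : b = ‖z‖ * Real.sin z.arg := (Complex.norm_mul_sin_arg z).symm
  have h : ∀ φ, |a * Real.cos φ + b * Real.sin φ| = ‖z‖ * |Real.cos (φ - z.arg)| := by
    intro φ
    rw [Real.cos_sub]
    nth_rw 1 [ha, hb]
    rw [← abs_of_nonneg (norm_nonneg z), ← abs_mul, abs_of_nonneg (norm_nonneg z)]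
    congr 1; ring
  simp_rw [h]
  rw [intervalIntegral.integral_const_mul, hz, dsM,
    intervalIntegral.integral_comp_sub_right (fun φ => |Real.cos φ|)]
  congr 1
  have hper : Function.Periodic (fun φ => |Real.cos φ|) (2 * π) := fun x => by simp
  have := hper.intervalIntegral_add_eq (0 - z.arg) 0
  rw [zero_add] at this
  rw [← this]
  congr 1; ring

theorem ds_young (a b : ℝ) (p : ℕ) (hp : 2 ≤ p) (hpe : Even p) :
    a ^ p - b ^ p ≤ p * (a ^ (p - 1) * (a - b)) := by
  obtain ⟨q, rfl⟩ : ∃ q, p = q + 1 := ⟨p - 1, by omega⟩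
  rw [Nat.add_sub_cancel]
  rcases eq_or_ne a 0 with rfl | ha
  · rw [zero_pow (by omega), zero_pow (by omega)]
    have := hpe.pow_nonneg b
    linarith
  · have hr : 1 + ((q + 1 : ℕ) : ℝ) * (b / a - 1) ≤ (b / a) ^ (q + 1) := by
      rcases le_or_gt (-2) (b / a - 1) with h | h
      · simpa using one_add_mul_le_pow h (q + 1)
      · have h1 := hpe.pow_nonneg (b / a)
        have h2 : (1 : ℝ) ≤ ((q + 1 : ℕ) : ℝ) := by exact_mod_cast (by omega)
        nlinarith
    have hap : 0 < a ^ (q + 1) := lt_of_le_of_ne (hpe.pow_nonneg a) (pow_ne_zero _ ha).symm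
    have h3 := mul_le_mul_of_nonneg_left hr hap.le
    rw [div_pow, mul_div_cancel₀ _ hap.ne'] at h3
    have h4 : a ^ (q + 1) * (1 + ((q + 1 : ℕ) : ℝ) * (b / a - 1))
        = a ^ (q + 1) - ((q + 1 : ℕ) : ℝ) * (a ^ q * (a - b)) := by
      field_simp; ring
    linarith

noncomputable def dsRep (t : UnitAddTorus (Fin 2)) : ℝ × ℝ :=
  (2 * π * (AddCircle.equivIoc (1:ℝ) 0 (t 0)).1, 2 * π * (AddCircle.equivIoc (1:ℝ) 0 (t 1)).1)

theorem dsRep_meas : Measurable dsRep := by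
  have h : Measurable fun t : AddCircle (1:ℝ) => (AddCircle.equivIoc (1:ℝ) 0 t).1 :=
    measurable_subtype_coe.comp (AddCircle.measurableEquivIoc 1 0).measurable
  unfold dsRep
  refine Measurable.prodMk ?_ ?_
  · exact (h.comp (measurable_pi_apply (X := fun _ : Fin 2 => AddCircle (1:ℝ)) 0)).const_mul _
  · exact (h.comp (measurable_pi_apply (X := fun _ : Fin 2 => AddCircle (1:ℝ)) 1)).const_mul _

theorem dsRep_mem (t : UnitAddTorus (Fin 2)) :
    dsRep t ∈ Set.Icc 0 (2 * π) ×ˢ Set.Icc 0 (2 * π) := by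
  have h : ∀ s : AddCircle (1:ℝ), 2 * π * (AddCircle.equivIoc (1:ℝ) 0 s).1 ∈ Set.Icc 0 (2 * π) := by
    intro s
    have := (AddCircle.equivIoc (1:ℝ) 0 s).2
    have hp := Real.two_pi_pos
    constructor
    · exact mul_nonneg hp.le this.1.le
    · have := this.2
      nlinarith
  exact ⟨h _, h _⟩

open scoped Pointwise in
theorem ds_transfer (h : ℝ × ℝ → ℂ) :
    ∫ t, h (dsRep t) ∂(Measure.pi fun _ : Fin 2 => (AddCircle.haarAddCircle : Measure UnitAddCircle))
      = (1 / (2 * π) ^ 2) * ∫ x, h x ∂μbox := by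
  refine (UnitAddTorus.integral_preimage (fun t => h (dsRep t)) 0).trans ?_
  have h1 : ∫ (x : Fin 2 → ℝ) in {x : Fin 2 → ℝ | ∀ i, x i ∈ Set.Ioc ((0 : Fin 2 → ℝ) i) ((0 : Fin 2 → ℝ) i + 1)},
      h (dsRep fun i => (x i : UnitAddCircle)) =
      ∫ (x : Fin 2 → ℝ) in {x : Fin 2 → ℝ | ∀ i, x i ∈ Set.Ioc ((0 : Fin 2 → ℝ) i) ((0 : Fin 2 → ℝ) i + 1)},
      h (2 * π * x 0, 2 * π * x 1) := by
    refine setIntegral_congr_fun (MeasurableSet.univ_pi' fun i => measurableSet_Ioc) ?_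
    intro x hx
    simp only [dsRep]
    have e0 : x 0 ∈ Set.Ioc (0:ℝ) (0 + 1) := hx 0
    have e1 : x 1 ∈ Set.Ioc (0:ℝ) (0 + 1) := hx 1
    rw [AddCircle.equivIoc_coe_eq e0, AddCircle.equivIoc_coe_eq e1]
  rw [h1]
  have h2 := (volume_preserving_finTwoArrow ℝ).setIntegral_preimage_emb
    (MeasurableEquiv.measurableEmbedding _) (fun x : ℝ × ℝ => h ((2 * π) • x))
    (Set.Ioc 0 1 ×ˢ Set.Ioc 0 1)
  have h3 : MeasurableEquiv.finTwoArrow ⁻¹' (Set.Ioc (0:ℝ) 1 ×ˢ Set.Ioc (0:ℝ) 1) =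
      {x : Fin 2 → ℝ | ∀ i, x i ∈ Set.Ioc ((0 : Fin 2 → ℝ) i) ((0 : Fin 2 → ℝ) i + 1)} := by
    ext x
    simp [MeasurableEquiv.finTwoArrow, Fin.forall_fin_two]
  rw [h3] at h2
  refine Eq.trans ?_ (h2.trans ?_)
  · rfl
  · rw [Measure.setIntegral_comp_smul_of_pos _ _ _ Real.two_pi_pos]
    have h4 : (2 * π) • (Set.Ioc (0:ℝ) 1 ×ˢ Set.Ioc (0:ℝ) 1) =
        Set.Ioc 0 (2 * π) ×ˢ Set.Ioc 0 (2 * π) := by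
      rw [Set.smul_set_prod, LinearOrderedField.smul_Ioc Real.two_pi_pos]
      simp
    rw [h4, μbox]
    have h5 : volume.restrict (Set.Ioc 0 (2 * π) ×ˢ Set.Ioc 0 (2 * π)) =
      (volume : Measure (ℝ × ℝ)).restrict (Set.Icc 0 (2 * π) ×ˢ Set.Icc 0 (2 * π)) :=
      Measure.restrict_congr_set (Measure.set_prod_ae_eq Ioc_ae_eq_Icc Ioc_ae_eq_Icc)
    rw [h5, Module.finrank_prod, Module.finrank_self, Complex.real_smul]
    push_cast
    norm_num

theorem ds_memLp (f : ℝ × ℝ → ℝ) (hf : Continuous f) :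
    MemLp (fun t => (f (dsRep t) : ℂ)) 2
      (Measure.pi fun _ : Fin 2 => (AddCircle.haarAddCircle : Measure UnitAddCircle)) := by
  obtain ⟨C, hC⟩ := (isCompact_Icc.prod isCompact_Icc).exists_bound_of_continuousOn
    (s := Set.Icc 0 (2 * π) ×ˢ Set.Icc 0 (2 * π)) hf.continuousOn
  refine MemLp.of_bound ?_ C ?_
  · exact (Complex.measurable_ofReal.comp (hf.measurable.comp dsRep_meas)).aestronglyMeasurable
  · refine Filter.Eventually.of_forall fun t => ?_
    rw [Complex.norm_real]
    exact hC _ (dsRep_mem t)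

theorem ds_mFourier (n : Fin 2 → ℤ) (t : UnitAddTorus (Fin 2)) :
    UnitAddTorus.mFourier (-n) t = Complex.exp (-Complex.I *
      (((n 0 : ℤ) : ℝ) * (dsRep t).1 + ((n 1 : ℤ) : ℝ) * (dsRep t).2)) := by
  have h : ∀ (m : ℤ) (s : UnitAddCircle), fourier (-m) s = Complex.exp (-Complex.I *
      ((m : ℝ) * ((2 * π * (AddCircle.equivIoc (1:ℝ) 0 s).1 : ℝ) : ℂ))) := by
    intro m s
    have hs : (((AddCircle.equivIoc (1:ℝ) 0 s).1 : ℝ) : UnitAddCircle) = s :=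
      (AddCircle.equivIoc (1:ℝ) 0).symm_apply_apply s
    conv_lhs => rw [← hs]
    rw [fourier_coe_apply]
    congr 1
    push_cast
    ring
  simp only [UnitAddTorus.mFourier, ContinuousMap.coe_mk, Fin.prod_univ_two, Pi.neg_apply]
  rw [h, h, ← Complex.exp_add, dsRep]
  congr 1
  ring

theorem ds_coeff (f : ℝ × ℝ → ℝ) (F : UnitAddTorus (Fin 2) → ℂ)
    (hF : F =ᵐ[Measure.pi fun _ : Fin 2 => (AddCircle.haarAddCircle : Measure UnitAddCircle)]
      fun t => (f (dsRep t) : ℂ)) (n : Fin 2 → ℤ) :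
    UnitAddTorus.mFourierCoeff F n = fCoeffR f (n 0, n 1) := by
  rw [fCoeffR, ← ds_transfer]
  refine integral_congr_ae ?_
  filter_upwards [hF] with t ht
  rw [ht, ds_mFourier, smul_eq_mul, mul_comm]

theorem ds_parseval (f g : ℝ × ℝ → ℝ) (hf : Continuous f) (hg : Continuous g) :
    HasSum (fun j : ℤ × ℤ => starRingEnd ℂ (fCoeffR f j) * fCoeffR g j)
      (((1 / (2 * π) ^ 2 * ∫ x, f x * g x ∂μbox : ℝ)) : ℂ) := by
  have hF := ds_memLp f hf
  have hG := ds_memLp g hg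
  have h := UnitAddTorus.hasSum_prod_mFourierCoeff (hF.toLp _) (hG.toLp _)
  have e : HasSum (fun n : Fin 2 → ℤ => starRingEnd ℂ (fCoeffR f (n 0, n 1)) * fCoeffR g (n 0, n 1))
      (((1 / (2 * π) ^ 2 * ∫ x, f x * g x ∂μbox : ℝ)) : ℂ) := by
    convert! h using 1
    · funext n
      rw [ds_coeff f _ hF.coeFn_toLp, ds_coeff g _ hG.coeFn_toLp]
    · have h1 := ds_transfer fun x => ((f x * g x : ℝ) : ℂ)
      rw [integral_complex_ofReal (μ := μbox)] at h1
      push_cast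
      push_cast at h1
      rw [← h1]
      refine integral_congr_ae ?_
      filter_upwards [hF.coeFn_toLp, hG.coeFn_toLp] with t h1 h2
      rw [h1, h2, Complex.conj_ofReal]
  exact (Equiv.hasSum_iff (finTwoArrowEquiv ℤ)).1 e

theorem ds_box_integrable {E : Type*} [NormedAddCommGroup E] (f : ℝ × ℝ → E) (hf : Continuous f) :
    Integrable f μbox :=
  hf.continuousOn.integrableOn_compact (isCompact_Icc.prod isCompact_Icc)

theorem ds_box_iterated {E : Type*} [NormedAddCommGroup E] [NormedSpace ℝ E]
    (f : ℝ × ℝ → E) (hf : Continuous f) :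
    ∫ x, f x ∂μbox = ∫ a in (0:ℝ)..(2 * π), ∫ b in (0:ℝ)..(2 * π), f (a, b) := by
  have h := setIntegral_prod (μ := (volume : Measure ℝ)) (ν := (volume : Measure ℝ)) f
    (ds_box_integrable f hf)
  refine h.trans ?_
  simp_rw [intervalIntegral.integral_of_le Real.two_pi_pos.le, integral_Icc_eq_integral_Ioc]

theorem ds_box_translate {E : Type*} [NormedAddCommGroup E] [NormedSpace ℝ E]
    (f : ℝ × ℝ → E) (hf : Continuous f)
    (h1 : ∀ a b, f (a + 2 * π, b) = f (a, b)) (h2 : ∀ a b, f (a, b + 2 * π) = f (a, b))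
    (y : ℝ × ℝ) : ∫ x, f (x + y) ∂μbox = ∫ x, f x ∂μbox := by
  rw [ds_box_iterated f hf, ds_box_iterated (fun x => f (x + y)) (by fun_prop)]
  have e : ∀ a, ∫ b in (0:ℝ)..(2 * π), f ((a, b) + y) =
      ∫ b in (0:ℝ)..(2 * π), f (a + y.1, b) := by
    intro a
    have hp : Function.Periodic (fun b => f (a + y.1, b)) (2 * π) := fun b => h2 _ _
    have := hp.intervalIntegral_add_eq y.2 0
    rw [zero_add] at this
    rw [← this]
    have h3 := intervalIntegral.integral_comp_add_right (a := 0) (b := 2 * π)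
      (fun b => f (a + y.1, b)) y.2
    rw [zero_add, add_comm (2 * π)] at h3
    exact h3
  simp_rw [e]
  have hp : Function.Periodic (fun a => ∫ b in (0:ℝ)..(2 * π), f (a, b)) (2 * π) := fun a => by
    simp only [h1]
  have := hp.intervalIntegral_add_eq y.1 0
  rw [zero_add] at this
  rw [← this]
  have h3 := intervalIntegral.integral_comp_add_right (a := 0) (b := 2 * π)
      (fun a => ∫ b in (0:ℝ)..(2 * π), f (a, b)) y.1
  rw [zero_add, add_comm (2 * π)] at h3
  exact h3

theorem ds_coeff_translate (f : ℝ × ℝ → ℝ) (hf : Continuous f) (hp : Periodic2 f)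
    (y : ℝ × ℝ) (j : ℤ × ℤ) :
    fCoeffR (fun x => f (x + y)) j =
      Complex.exp (((j.1 * y.1 + j.2 * y.2 : ℝ) : ℂ) * Complex.I) * fCoeffR f j := by
  have hexp : ∀ m : ℤ, Complex.exp (-Complex.I * (m * (2 * π))) = 1 := by
    intro m
    rw [Complex.exp_eq_one_iff]
    exact ⟨-m, by push_cast; ring⟩
  have h := ds_box_translate (fun x => (f x : ℂ) *
      Complex.exp (-Complex.I * ((j.1 : ℝ) * x.1 + (j.2 : ℝ) * x.2))) (by fun_prop)
    (by
      intro a b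
      have := (hp (a, b)).1
      simp only at this ⊢
      rw [this]
      congr 1
      rw [← mul_one (Complex.exp (-Complex.I * ((j.1 : ℝ) * (a : ℝ) + (j.2 : ℝ) * (b : ℝ)))),
        ← hexp j.1, ← Complex.exp_add]
      congr 1
      push_cast
      ring)
    (by
      intro a b
      have := (hp (a, b)).2
      simp only at this ⊢
      rw [this]
      congr 1
      rw [← mul_one (Complex.exp (-Complex.I * ((j.1 : ℝ) * (a : ℝ) + (j.2 : ℝ) * (b : ℝ)))),
        ← hexp j.2, ← Complex.exp_add]
      congr 1
      push_cast
      ring) y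
  rw [fCoeffR, fCoeffR, ← h, mul_left_comm (Complex.exp _) (1 / (2 * (π : ℂ)) ^ 2) (integral _ _)]
  refine congrArg (fun z : ℂ => (1 / (2 * (π : ℂ)) ^ 2) * z) ?_
  rw [← integral_const_mul]
  refine integral_congr_ae (Filter.Eventually.of_forall fun x => ?_)
  simp only [Prod.fst_add, Prod.snd_add]
  rw [mul_left_comm, ← Complex.exp_add]
  congr 2
  push_cast
  ring

theorem ds_translate_le (θ : ℝ × ℝ → ℝ) (hθ : Continuous θ) (hθp : Periodic2 θ)
    (p : ℕ) (hp : 2 ≤ p) (hpe : Even p) (y : ℝ × ℝ) :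
    ∫ x, θ x ^ (p - 1) * θ (x + y) ∂μbox ≤ ∫ x, θ x ^ (p - 1) * θ x ∂μbox := by
  have h1 := ds_box_translate (fun x => θ x ^ p) (by fun_prop)
    (fun a b => by rw [(hθp (a, b)).1]) (fun a b => by rw [(hθp (a, b)).2]) y
  have i1 := ds_box_integrable (fun x => θ x ^ p) (by fun_prop)
  have i2 := ds_box_integrable (fun x => θ (x + y) ^ p) (by fun_prop)
  have i3 := ds_box_integrable (fun x => θ x ^ (p - 1) * θ x) (by fun_prop)
  have i4 := ds_box_integrable (fun x => θ x ^ (p - 1) * θ (x + y)) (by fun_prop)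
  have h2 : ∫ x, (θ x ^ p - θ (x + y) ^ p) ∂μbox ≤
      ∫ x, p * (θ x ^ (p - 1) * θ x - θ x ^ (p - 1) * θ (x + y)) ∂μbox := by
    refine integral_mono (i1.sub i2) ((i3.sub i4).const_mul _) fun x => ?_
    have := ds_young (θ x) (θ (x + y)) p hp hpe
    simp only
    linarith
  rw [integral_sub i1 i2, integral_const_mul, integral_sub i3 i4, h1, sub_self] at h2
  have hp0 : (0 : ℝ) < p := by exact_mod_cast (by omega)
  have := nonneg_of_mul_nonneg_right h2 hp0
  linarith

theorem ds_key (θ : ℝ × ℝ → ℝ) (hθ : Continuous θ) (hθp : Periodic2 θ)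
    (p : ℕ) (hp : 2 ≤ p) (hpe : Even p) (y : ℝ × ℝ) :
    0 ≤ ∑' j : ℤ × ℤ, (starRingEnd ℂ (fCoeffR (fun x => θ x ^ (p - 1)) j) * fCoeffR θ j).re *
      (1 - Real.cos (j.1 * y.1 + j.2 * y.2)) := by
  have hg : Continuous fun x => θ x ^ (p - 1) := by fun_prop
  have a0 := Complex.hasSum_re (ds_parseval _ θ hg hθ)
  have a1 := Complex.hasSum_re (ds_parseval _ (fun x => θ (x + y)) hg (by fun_prop))
  have a2 := Complex.hasSum_re (ds_parseval _ (fun x => θ (x + -y)) hg (by fun_prop))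
  have l1 := ds_translate_le θ hθ hθp p hp hpe y
  have l2 := ds_translate_le θ hθ hθp p hp hpe (-y)
  have h := a0.sub ((a1.add a2).mul_left (1 / 2))
  rw [Complex.ofReal_re, Complex.ofReal_re, Complex.ofReal_re] at h
  have e : (fun j : ℤ × ℤ =>
      (starRingEnd ℂ (fCoeffR (fun x => θ x ^ (p - 1)) j) * fCoeffR θ j).re *
      (1 - Real.cos (j.1 * y.1 + j.2 * y.2))) = fun j : ℤ × ℤ =>
      (starRingEnd ℂ (fCoeffR (fun x => θ x ^ (p - 1)) j) * fCoeffR θ j).re - 1 / 2 *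
      ((starRingEnd ℂ (fCoeffR (fun x => θ x ^ (p - 1)) j) * fCoeffR (fun x => θ (x + y)) j).re +
      (starRingEnd ℂ (fCoeffR (fun x => θ x ^ (p - 1)) j) * fCoeffR (fun x => θ (x + -y)) j).re)
      := by
    funext j
    rw [ds_coeff_translate θ hθ hθp y j, ds_coeff_translate θ hθ hθp (-y) j]
    set s : ℝ := j.1 * y.1 + j.2 * y.2 with hs
    have hs2 : (j.1 * (-y).1 + j.2 * (-y).2 : ℝ) = -s := by
      rw [hs, Prod.fst_neg, Prod.snd_neg]; ring
    rw [hs2, mul_left_comm, mul_left_comm (starRingEnd ℂ _) (Complex.exp (((-s : ℝ) : ℂ) * _))]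
    rw [Complex.mul_re (Complex.exp _), Complex.mul_re (Complex.exp _),
      Complex.exp_ofReal_mul_I_re, Complex.exp_ofReal_mul_I_re,
      Complex.exp_ofReal_mul_I_im, Complex.exp_ofReal_mul_I_im, Real.cos_neg, Real.sin_neg]
    ring
  rw [e, h.tsum_eq]
  have : (0 : ℝ) ≤ 1 / (2 * π) ^ 2 := by positivity
  nlinarith [mul_le_mul_of_nonneg_left l1 this, mul_le_mul_of_nonneg_left l2 this]

/-- Positivity of the dissipation term: for smooth mean-zero periodic `θ` on the
2-torus and `Λθ = (-Δ)^{1/2}θ` (given spectrally by `(Λθ)^(j) = |j| θ̂(j)`), and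
for any even integer `p ≥ 2` (so `|θ|^{p-2}θ = θ^{p-1}`), one has
`∫ |θ|^{p-2} θ Λθ dx ≥ 0`. -/
theorem dissipation_sign (θ Λθ : ℝ × ℝ → ℝ)
    (hθ : ContDiff ℝ (⊤ : ℕ∞) θ) (hΛθ : Continuous Λθ)
    (hθp : Periodic2 θ) (hΛθp : Periodic2 Λθ)
    (hmean : fCoeffR θ 0 = 0)
    (hspec : ∀ j, fCoeffR Λθ j = (en j : ℂ) * fCoeffR θ j)
    (p : ℕ) (hp : 2 ≤ p) (hpe : Even p) :
    0 ≤ ∫ x, (θ x) ^ (p - 1) * Λθ x ∂μbox := by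
  have hc : Continuous θ := hθ.continuous
  have hg : Continuous fun x => θ x ^ (p - 1) := by fun_prop
  set c : ℤ × ℤ → ℝ := fun j =>
    (starRingEnd ℂ (fCoeffR (fun x => θ x ^ (p - 1)) j) * fCoeffR θ j).re with hcdef
  have hP := Complex.hasSum_re (ds_parseval _ Λθ hg hΛθ)
  have e : (fun j : ℤ × ℤ =>
      (starRingEnd ℂ (fCoeffR (fun x => θ x ^ (p - 1)) j) * fCoeffR Λθ j).re) =
      fun j => c j * en j := by
    funext j
    rw [hspec, mul_left_comm, Complex.re_ofReal_mul, mul_comm]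
  rw [e, Complex.ofReal_re] at hP
  have hen : ∀ j, 0 ≤ en j := fun j => Real.sqrt_nonneg _
  have hsum : Summable fun j => |c j| * en j := by
    refine hP.summable.abs.congr fun j => ?_
    rw [abs_mul, abs_of_nonneg (hen j)]
  have hdir : ∀ (φ : ℝ) (j : ℤ × ℤ),
      |(j.1 : ℝ) * Real.cos φ + (j.2 : ℝ) * Real.sin φ| ≤ en j := by
    intro φ j
    refine Real.abs_le_sqrt ?_
    nlinarith [sq_nonneg ((j.1 : ℝ) * Real.sin φ - (j.2 : ℝ) * Real.cos φ),
      Real.sin_sq_add_cos_sq φ]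
  -- integrate in the radial variable
  have step1 : ∀ φ : ℝ,
      0 ≤ ∑' j : ℤ × ℤ, c j * |(j.1 : ℝ) * Real.cos φ + (j.2 : ℝ) * Real.sin φ| := by
    intro φ
    have h := ds_sum_nonneg (volume.restrict (Set.Ioi (0:ℝ))) c
      (fun j : ℤ × ℤ => |(j.1 : ℝ) * Real.cos φ + (j.2 : ℝ) * Real.sin φ| * dsK)
      (fun j r => (1 - Real.cos (((j.1 : ℝ) * Real.cos φ + (j.2 : ℝ) * Real.sin φ) * r)) / r ^ 2)
      (fun j r => div_nonneg (sub_nonneg.2 (Real.cos_le_one _)) (sq_nonneg r))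
      (fun j => (ds_int1 _).1) (fun j => (ds_int1 _).2)
      (by
        refine Summable.of_nonneg_of_le (fun j => ?_) (fun j => ?_) (hsum.mul_right dsK)
        · have := dsK_pos; positivity
        · rw [← mul_assoc]
          have := dsK_pos
          have := hdir φ j
          gcongr)
      (by
        refine Filter.Eventually.of_forall fun r => ?_
        have hk := ds_key θ hc hθp p hp hpe (r * Real.cos φ, r * Real.sin φ)
        have : (fun j : ℤ × ℤ => c j * ((1 - Real.cos (((j.1 : ℝ) * Real.cos φ +
            (j.2 : ℝ) * Real.sin φ) * r)) / r ^ 2)) = fun j : ℤ × ℤ => (c j *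
            (1 - Real.cos (j.1 * (r * Real.cos φ) + j.2 * (r * Real.sin φ)))) / r ^ 2 := by
          funext j
          rw [mul_div_assoc]
          congr 4
          ring
        rw [this, tsum_div_const]
        exact div_nonneg hk (sq_nonneg r))
    simp_rw [← mul_assoc] at h
    rw [tsum_mul_right] at h
    exact nonneg_of_mul_nonneg_left h dsK_pos
  -- integrate in the angular variable
  have step2 := ds_sum_nonneg (volume.restrict (Set.Ioc 0 (2 * π))) c
    (fun j => en j * dsM)
    (fun j φ => |(j.1 : ℝ) * Real.cos φ + (j.2 : ℝ) * Real.sin φ|)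
    (fun j φ => abs_nonneg _)
    (fun j => (Continuous.integrableOn_Ioc (by fun_prop)))
    (fun j => by
      rw [← intervalIntegral.integral_of_le Real.two_pi_pos.le, ds_int2]; rfl)
    (by simp_rw [← mul_assoc]; exact hsum.mul_right _)
    (Filter.Eventually.of_forall step1)
  simp_rw [← mul_assoc] at step2
  rw [tsum_mul_right, hP.tsum_eq] at step2
  have h3 := nonneg_of_mul_nonneg_left step2 dsM_pos
  exact nonneg_of_mul_nonneg_right h3 (by positivity)
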